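/- Let 𝐀 be a BBL transformation of bandwidth (p,q) on V_d^S, let V_{1,∞} be the space of half-infinite sequences (vanishing at indices j ≤ 0), A = P_{1,∞} 𝐀 |_{V_{1,∞}} the induced infinite banded block-Toeplitz transformation, and P_B the right bulk projector, which sets to zero the entries with indices 1 ≤ j ≤ −p' and leaves the rest unchanged (P_B = id if p ≥ 0). Then P_{1,∞} Ker 𝐀 ⊆ Ker(P_B A); and if p ≤ 0 and a_p is invertible, then Ker(P_B A) = P_{1,∞} Ker 𝐀. -/

import Mathlib

noncomputable section

/-- The space of doubly-infinite sequences with values in `ℂ^d`. -/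
abbrev SeqSp (d : ℕ) : Type := ℤ → Fin d → ℂ

/-- The shift `(Ψ_j)_j ↦ (Ψ_{j+n})_j`; for `n = 1` this is the left shift `T`. -/
def shiftBy (d : ℕ) (n : ℤ) : Module.End ℂ (SeqSp d) where
  toFun Ψ := fun j => Ψ (j + n)
  map_add' _ _ := rfl
  map_smul' _ _ := rfl

/-- Entrywise multiplication of a sequence by a fixed `d × d` matrix. -/
def matOp (d : ℕ) (m : Matrix (Fin d) (Fin d) ℂ) : Module.End ℂ (SeqSp d) where
  toFun Ψ := fun j => m.mulVec (Ψ j)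
  map_add' Ψ Φ := by funext j; simp [Matrix.mulVec_add]
  map_smul' c Ψ := by funext j; simp [Matrix.mulVec_smul]

/-- The banded block-Laurent (BBL) transformation `(𝐀Ψ)_j = ∑_{r=p}^{q} a_r ψ_{j+r}`. -/
def bbl (d : ℕ) (a : ℤ → Matrix (Fin d) (Fin d) ℂ) (p q : ℤ) : Module.End ℂ (SeqSp d) :=
  ∑ r ∈ Finset.Icc p q, matOp d (a r) * shiftBy d r

/-- The projection `P_S` replacing every entry with index outside `S` by zero. -/
def projOn (d : ℕ) (S : Set ℤ) : Module.End ℂ (SeqSp d) where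
  toFun Ψ := fun j => S.indicator Ψ j
  map_add' Ψ Φ := by
    funext j
    by_cases h : j ∈ S <;> simp [Set.indicator_apply, h]
  map_smul' c Ψ := by
    funext j
    by_cases h : j ∈ S <;> simp [Set.indicator_apply, h]

/-- The window `{j : ℤ | Lb ≤ j ≤ Rb}`, with possibly infinite endpoints. -/
def windowSet (Lb : WithBot ℤ) (Rb : WithTop ℤ) : Set ℤ :=
  {j : ℤ | Lb ≤ (j : WithBot ℤ) ∧ (j : WithTop ℤ) ≤ Rb}

/-- Sequences supported in `S` (vanishing at every index outside `S`): the space `V_{L,R}`. -/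
def suppIn (d : ℕ) (S : Set ℤ) : Submodule ℂ (SeqSp d) where
  carrier := {Ψ | ∀ j ∉ S, Ψ j = 0}
  add_mem' := by
    intro Ψ Φ hΨ hΦ j hj
    simp [Pi.add_apply, hΨ j hj, hΦ j hj]
  zero_mem' := fun j _ => rfl
  smul_mem' := by
    intro c Ψ hΨ j hj
    simp [Pi.smul_apply, hΨ j hj]

/-- Sequences vanishing at every index of `S`. -/
def vanishOn (d : ℕ) (S : Set ℤ) : Submodule ℂ (SeqSp d) where
  carrier := {Ψ | ∀ j ∈ S, Ψ j = 0}
  add_mem' := by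
    intro Ψ Φ hΨ hΦ j hj
    simp [Pi.add_apply, hΨ j hj, hΦ j hj]
  zero_mem' := fun j _ => rfl
  smul_mem' := by
    intro c Ψ hΨ j hj
    simp [Pi.smul_apply, hΨ j hj]

/-- The bulk solution space `M_{Lb,Rb} = Ker (P_{Lb−p',Rb−q'} 𝐀 |_{V_{Lb,Rb}})`, viewed as a
submodule of the full sequence space: sequences supported in the window `[Lb,Rb]` whose image
under `𝐀` vanishes on the bulk window `[Lb−p', Rb−q']` (with `p' = min p 0`, `q' = max q 0`). -/
def bulkSol (d : ℕ) (a : ℤ → Matrix (Fin d) (Fin d) ℂ) (p q : ℤ)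
    (Lb : WithBot ℤ) (Rb : WithTop ℤ) : Submodule ℂ (SeqSp d) :=
  suppIn d (windowSet Lb Rb) ⊓
    (vanishOn d (windowSet (Lb + ((-min p 0 : ℤ) : WithBot ℤ))
        (Rb + ((-max q 0 : ℤ) : WithTop ℤ)))).comap (bbl d a p q)

/-- Falling-factorial type product `j^{(v)} = (j−v+1)(j−v+2)⋯j`. -/
def ff (j : ℤ) (v : ℕ) : ℤ := ∏ i ∈ Finset.range v, (j - i)

/-- The scalar sequence `Φ_{z,v}`, with `j`-th entry `j^{(v−1)} z^{j−v+1}`, and `Φ_{z,0} = 0`. -/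
def Phi (z : ℂ) (v : ℕ) : ℤ → ℂ :=
  fun j => if v = 0 then 0 else (ff j (v - 1) : ℂ) * z ^ (j - (v : ℤ) + 1)

/-- The vector sequence `Φ_{z,v}|m⟩`. -/
def PhiVec (d : ℕ) (z : ℂ) (v : ℕ) (m : Fin d) : SeqSp d :=
  fun j => Phi z v j • (Pi.single m 1 : Fin d → ℂ)

/-- The subspace `T_{z,s} = Span{Φ_{z,v}|m⟩ : 1 ≤ v ≤ s, 1 ≤ m ≤ d}`. -/
def Tspace (d : ℕ) (z : ℂ) (s : ℕ) : Submodule ℂ (SeqSp d) :=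
  Submodule.span ℂ {Ψ : SeqSp d | ∃ v ∈ Finset.Icc 1 s, ∃ m : Fin d, Ψ = PhiVec d z v m}

/-- The symbol `A(w,w⁻¹) = ∑_{r=p}^q w^r a_r` as a matrix of Laurent polynomials. -/
def symbol (d : ℕ) (a : ℤ → Matrix (Fin d) (Fin d) ℂ) (p q : ℤ) :
    Matrix (Fin d) (Fin d) (LaurentPolynomial ℂ) :=
  ∑ r ∈ Finset.Icc p q, (LaurentPolynomial.T r : LaurentPolynomial ℂ) • (a r).map (fun c => LaurentPolynomial.C c)

/-- The evaluation `A(z,z⁻¹) = ∑_{r=p}^q z^r a_r` of the symbol at `z ≠ 0`. -/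
def symbolEval (d : ℕ) (a : ℤ → Matrix (Fin d) (Fin d) ℂ) (p q : ℤ) (z : ℂ) :
    Matrix (Fin d) (Fin d) ℂ :=
  ∑ r ∈ Finset.Icc p q, z ^ r • a r

/-- The `k`-th derivative `A^{(k)}(z,z⁻¹) = ∑_{r=p}^q r(r−1)⋯(r−k+1) z^{r−k} a_r`. -/
def symbolDeriv (d : ℕ) (a : ℤ → Matrix (Fin d) (Fin d) ℂ) (p q : ℤ) (k : ℕ) (z : ℂ) :
    Matrix (Fin d) (Fin d) ℂ :=
  ∑ r ∈ Finset.Icc p q, ((ff r k : ℂ) * z ^ (r - (k : ℤ))) • a r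

/-- The generalized kernel `⋃_k Ker (f^k)` of an endomorphism. -/
def genKer (d : ℕ) (f : Module.End ℂ (SeqSp d)) : Submodule ℂ (SeqSp d) :=
  ⨆ k : ℕ, LinearMap.ker (f ^ k)

/-- `F_L^− `: the generalized kernel of the unilateral shift `P_{L,∞}T` on `M_{L,∞}`. -/
def Fminus (d : ℕ) (a : ℤ → Matrix (Fin d) (Fin d) ℂ) (p q : ℤ) (L : ℤ) :
    Submodule ℂ (SeqSp d) :=
  bulkSol d a p q (L : WithBot ℤ) ⊤ ⊓
    genKer d (projOn d (windowSet (L : WithBot ℤ) ⊤) * shiftBy d 1)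

/-- `F_R^+`: the generalized kernel of the shift `P_{−∞,R}T⁻¹` on `M_{−∞,R}`. -/
def Fplus (d : ℕ) (a : ℤ → Matrix (Fin d) (Fin d) ℂ) (p q : ℤ) (R : ℤ) :
    Submodule ℂ (SeqSp d) :=
  bulkSol d a p q ⊥ (R : WithTop ℤ) ⊓
    genKer d (projOn d (windowSet ⊥ (R : WithTop ℤ)) * shiftBy d (-1))

/-- The left shift on scalar sequences. -/
def shiftS : Module.End ℂ (ℤ → ℂ) where
  toFun φ := fun j => φ (j + 1)
  map_add' _ _ := rfl
  map_smul' _ _ := rfl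

/-- The linear map on `SeqSp d` induced by a diagonal matrix polynomial with diagonal entries
`g m`: it acts on the `m`-th component of a sequence as `g m` evaluated at the left shift. -/
def diagPolyOp (d : ℕ) (g : Fin d → Polynomial ℂ) : Module.End ℂ (SeqSp d) where
  toFun Ψ := fun j m => Polynomial.aeval shiftS (g m) (fun i => Ψ i m) j
  map_add' Ψ Φ := by
    funext j m
    show Polynomial.aeval shiftS (g m) ((fun i => Ψ i m) + (fun i => Φ i m)) j = _
    rw [map_add]
    rfl
  map_smul' c Ψ := by
    funext j m
    show Polynomial.aeval shiftS (g m) (c • (fun i => Ψ i m)) j = _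
    rw [map_smul]
    rfl

/-- The subspace of sequences with values in `Span{|m⟩ : d₀ < m ≤ d}` (the range of `ρ_d(π)`). -/
def piRange (d d₀ : ℕ) : Submodule ℂ (SeqSp d) where
  carrier := {Ψ | ∀ j : ℤ, ∀ m : Fin d, (m : ℕ) < d₀ → Ψ j m = 0}
  add_mem' := by
    intro Ψ Φ hΨ hΦ j m hm
    simp [Pi.add_apply, hΨ j m hm, hΦ j m hm]
  zero_mem' := fun j m _ => rfl
  smul_mem' := by
    intro c Ψ hΨ j m hm
    simp [Pi.smul_apply, hΨ j m hm]

/-- The Hilbert space `H` of square-summable half-infinite sequences, as a subspace of `SeqSp d`: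
sequences vanishing at indices `j ≤ 0` whose restriction to `j ≥ 1` is in `ℓ²`. -/
def Hspace (d : ℕ) : Submodule ℂ (SeqSp d) where
  carrier := {Ψ | (∀ j : ℤ, j ≤ 0 → Ψ j = 0) ∧ Memℓp (fun n : ℕ => Ψ ((n : ℤ) + 1)) 2}
  add_mem' := by
    intro Ψ Φ hΨ hΦ
    refine ⟨fun j hj => by simp [Pi.add_apply, hΨ.1 j hj, hΦ.1 j hj], ?_⟩
    exact hΨ.2.add hΦ.2
  zero_mem' := ⟨fun j _ => rfl, zero_memℓp⟩
  smul_mem' := by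
    intro c Ψ hΨ
    exact ⟨fun j hj => by simp [Pi.smul_apply, hΨ.1 j hj], hΨ.2.const_smul c⟩

theorem bbl_apply (d : ℕ) (a : ℤ → Matrix (Fin d) (Fin d) ℂ) (p q : ℤ) (Ψ : SeqSp d) (j : ℤ) :
    bbl d a p q Ψ j = ∑ r ∈ Finset.Icc p q, (a r).mulVec (Ψ (j + r)) := by
  simp only [bbl, LinearMap.sum_apply, Finset.sum_apply]
  rfl

/-- The `j`-th entry of `𝐀Ψ` depends only on the entries of `Ψ` at indices `≥ j + p`. -/
theorem bbl_congr (d : ℕ) (a : ℤ → Matrix (Fin d) (Fin d) ℂ) (p q : ℤ) {Ψ Φ : SeqSp d} {j : ℤ}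
    (h : ∀ r, p ≤ r → Ψ (j + r) = Φ (j + r)) : bbl d a p q Ψ j = bbl d a p q Φ j := by
  rw [bbl_apply, bbl_apply]
  exact Finset.sum_congr rfl fun r hr => by rw [h r (Finset.mem_Icc.1 hr).1]

theorem mem_windowSet_coe_top (L j : ℤ) : j ∈ windowSet (L : WithBot ℤ) ⊤ ↔ L ≤ j := by
  simp [windowSet]

theorem projOn_apply_one_top (d : ℕ) (Ψ : SeqSp d) (j : ℤ) :
    projOn d (windowSet ((1 : ℤ) : WithBot ℤ) ⊤) Ψ j = if 1 ≤ j then Ψ j else 0 := by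
  change (windowSet ((1 : ℤ) : WithBot ℤ) ⊤).indicator Ψ j = _
  classical
  rw [Set.indicator_apply]
  simp only [mem_windowSet_coe_top]

theorem mem_bulkSol_one_top (d : ℕ) (a : ℤ → Matrix (Fin d) (Fin d) ℂ) (p q : ℤ) (Ψ : SeqSp d) :
    Ψ ∈ bulkSol d a p q ((1 : ℤ) : WithBot ℤ) ⊤ ↔
      (∀ j < 1, Ψ j = 0) ∧ ∀ j, 1 - min p 0 ≤ j → bbl d a p q Ψ j = 0 := by
  have h₁ : ((1 : ℤ) : WithBot ℤ) + ((-min p 0 : ℤ) : WithBot ℤ) =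
      ((1 - min p 0 : ℤ) : WithBot ℤ) := by
    rw [← WithBot.coe_add, sub_eq_add_neg]
  have h₂ : (⊤ : WithTop ℤ) + ((-max q 0 : ℤ) : WithTop ℤ) = ⊤ := top_add _
  rw [bulkSol, h₁, h₂]
  change (∀ j ∉ windowSet ((1 : ℤ) : WithBot ℤ) ⊤, Ψ j = 0) ∧
    (∀ j ∈ windowSet ((1 - min p 0 : ℤ) : WithBot ℤ) ⊤, bbl d a p q Ψ j = 0) ↔ _
  simp only [mem_windowSet_coe_top, not_le]

theorem map_projOn_ker_bbl_le_bulkSol (d : ℕ) (a : ℤ → Matrix (Fin d) (Fin d) ℂ) (p q : ℤ) :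
    (LinearMap.ker (bbl d a p q)).map (projOn d (windowSet ((1 : ℤ) : WithBot ℤ) ⊤))
      ≤ bulkSol d a p q ((1 : ℤ) : WithBot ℤ) ⊤ := by
  rintro _ ⟨Ψ, hΨ, rfl⟩
  refine (mem_bulkSol_one_top d a p q _).2 ⟨fun j hj => ?_, fun j hj => ?_⟩
  · rw [projOn_apply_one_top, if_neg (not_le.2 hj)]
  · rw [bbl_congr d a p q (Φ := Ψ) fun r hr => ?_]
    · exact congrFun (LinearMap.mem_ker.1 hΨ) j
    · rw [projOn_apply_one_top, if_pos]
      have := min_le_left p 0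
      linarith

/-- The sequence agreeing with `Ψ` at indices `≥ 1` and continued to the left by solving
`(𝐀Φ)_{j-p} = 0` for the entry `Φ_j`. -/
def leftExt (d : ℕ) (a : ℤ → Matrix (Fin d) (Fin d) ℂ) (p q : ℤ) (Ψ : SeqSp d) (j : ℤ) :
    Fin d → ℂ :=
  if 1 ≤ j then Ψ j
  else -((a p)⁻¹.mulVec (∑ r ∈ (Finset.Ioc p q).attach,
    (a r.1).mulVec (leftExt d a p q Ψ (j - p + r.1))))
termination_by (1 - j).toNat
decreasing_by
  have := (Finset.mem_Ioc.1 r.2).1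
  omega

theorem leftExt_of_one_le (d : ℕ) (a : ℤ → Matrix (Fin d) (Fin d) ℂ) (p q : ℤ) (Ψ : SeqSp d)
    {j : ℤ} (hj : 1 ≤ j) : leftExt d a p q Ψ j = Ψ j := by
  rw [leftExt, if_pos hj]

theorem leftExt_of_lt_one (d : ℕ) (a : ℤ → Matrix (Fin d) (Fin d) ℂ) (p q : ℤ) (Ψ : SeqSp d)
    {j : ℤ} (hj : j < 1) :
    leftExt d a p q Ψ j = -((a p)⁻¹.mulVec (∑ r ∈ Finset.Ioc p q,
      (a r).mulVec (leftExt d a p q Ψ (j - p + r)))) := by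
  rw [leftExt, if_neg (not_le.2 hj), Finset.sum_attach (Finset.Ioc p q)
    fun r => (a r).mulVec (leftExt d a p q Ψ (j - p + r))]

theorem bbl_leftExt_of_lt (d : ℕ) (a : ℤ → Matrix (Fin d) (Fin d) ℂ) {p q : ℤ} (hpq : p ≤ q)
    (hu : IsUnit (a p)) (Ψ : SeqSp d) {j : ℤ} (hj : j + p < 1) :
    bbl d a p q (leftExt d a p q Ψ) j = 0 := by
  rw [bbl_apply, ← Finset.add_sum_Ioc_eq_sum_Icc hpq, leftExt_of_lt_one d a p q Ψ hj,
    Matrix.mulVec_neg, Matrix.mulVec_mulVec,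
    Matrix.mul_nonsing_inv _ ((Matrix.isUnit_iff_isUnit_det _).1 hu), Matrix.one_mulVec,
    add_sub_cancel_right, neg_add_cancel]

theorem stmt_17 (d : ℕ) (hd : 1 ≤ d) (p q : ℤ) (hpq : p ≤ q)
    (a : ℤ → Matrix (Fin d) (Fin d) ℂ) (hap : a p ≠ 0) (haq : a q ≠ 0) :
    (LinearMap.ker (bbl d a p q)).map
        (projOn d (windowSet ((1 : ℤ) : WithBot ℤ) ⊤))
      ≤ bulkSol d a p q ((1 : ℤ) : WithBot ℤ) ⊤ ∧
    (p ≤ 0 → IsUnit (a p) →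
      bulkSol d a p q ((1 : ℤ) : WithBot ℤ) ⊤
        = (LinearMap.ker (bbl d a p q)).map
            (projOn d (windowSet ((1 : ℤ) : WithBot ℤ) ⊤))) := by
  refine ⟨map_projOn_ker_bbl_le_bulkSol d a p q, fun hp hu => le_antisymm (fun Ψ hΨ => ?_)
    (map_projOn_ker_bbl_le_bulkSol d a p q)⟩
  obtain ⟨hsupp, hker⟩ := (mem_bulkSol_one_top d a p q Ψ).1 hΨ
  rw [min_eq_left hp] at hker
  refine ⟨leftExt d a p q Ψ, ?_, ?_⟩
  · ext1 j
    by_cases hj : 1 ≤ j + p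
    · rw [bbl_congr d a p q (Ψ := leftExt d a p q Ψ) (Φ := Ψ) (j := j)
        fun r hr => leftExt_of_one_le d a p q Ψ (by linarith)]
      exact hker j (by linarith)
    · exact bbl_leftExt_of_lt d a hpq hu Ψ (by linarith)
  · ext1 j
    rw [projOn_apply_one_top]
    split_ifs with hj
    · exact leftExt_of_one_le d a p q Ψ hj
    · exact (hsupp j (by linarith)).symm

end
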